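/- (Generalized eigenvalues are well approximated by eigenvalues of finite blocks.) Let V_hi be a hierarchical potential on ℤ^d with barrier height h > 4d+1, let 0 < β ≤ 1, and fix ω ∈ {0,1}^{ℤ^d}. Let ℰ ∈ [0, 4d+β] and suppose ψ : ℤ^d → ℝ satisfies H(ω)ψ = ℰψ pointwise, |ψ(m_ℰ)| ≥ 1 for some site m_ℰ ∈ ℤ^d, and |ψ(x)| ≤ C₁(d)·(|m_ℰ|+1)^{d/2+1}·(|x|+1)^{d/2+1} for all x ∈ ℤ^d, where C₁(d) depends only on d. Then there is a scale K₁ = K₁(ℰ, ω, h, β, d) > 0 such that for all k ≥ K₁: dist( ℰ, Spec(H_{Λ̄_k}) ∩ [−ι/2, 4d+β+ι/2] ) < exp( −(γ₀/50)·d_{k+1} ); in particular that intersection is nonempty. -/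

import Mathlib

noncomputable section

open scoped ENNReal

namespace HierABM

/-- Sites of the lattice `ℤ^d`. -/
abbrev Site (d : ℕ) := Fin d → ℤ

variable {d : ℕ}

/-- The `ℓ∞`-norm of a lattice site (as a natural number). -/
def linf (x : Site d) : ℕ := Finset.univ.sup fun i => (x i).natAbs

/-- The `ℓ∞`-distance between two lattice sites (as a natural number). -/
def linfDist (x y : Site d) : ℕ := Finset.univ.sup fun i => (x i - y i).natAbs

/-- The `ℓ¹`-distance between two lattice sites; `x ∼ y` means `l1dist x y = 1`. -/
def l1dist (x y : Site d) : ℤ := ∑ i, |x i - y i|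

/-- The `i`-th standard basis vector of `ℤ^d`. -/
def unit (i : Fin d) : Site d := fun j => if j = i then 1 else 0

/-- The discrete Laplacian `Δf(x) = ∑_{y ∼ x} f(y)`. -/
def discLap (f : Site d → ℝ) (x : Site d) : ℝ :=
  ∑ i : Fin d, (f (x + unit i) + f (x - unit i))

/-- The pointwise action of `H(ω) = 2d - Δ + V_hi + β ω`. -/
def hamAct (Vhi : Site d → ℝ) (β : ℝ) (ω : Site d → Bool)
    (f : Site d → ℝ) (x : Site d) : ℝ :=
  (2 * d + Vhi x + β * (if ω x then 1 else 0)) * f x - discLap f x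

/-- The Newtonian scales `d_k = d₀^(α^k)`, i.e. `d_{k+1} = d_k^α`. -/
def nscale (d₀ α : ℝ) (k : ℕ) : ℝ := d₀ ^ (α ^ k)

/-- The block `Λ_k(j) = {x : |x - j|_∞ ≤ 2⌊3 d_k⌋}`. -/
def LambdaS (d₀ α : ℝ) (k : ℕ) (j : Site d) : Set (Site d) :=
  {x | (linfDist x j : ℤ) ≤ 2 * ⌊3 * nscale d₀ α k⌋}

/-- `diam A ≤ r` in the `ℓ∞`-metric. -/
def diamLE (A : Set (Site d)) (r : ℤ) : Prop :=
  ∀ a ∈ A, ∀ b ∈ A, (linfDist a b : ℤ) ≤ r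

/-- `dist(A, B) ≥ r` in the `ℓ∞`-metric. -/
def setDistGE (A B : Set (Site d)) (r : ℝ) : Prop :=
  ∀ a ∈ A, ∀ b ∈ B, r ≤ (linfDist a b : ℝ)

/-- The potential with zero set `W` is `(k, N)`-hierarchical in `Λ_k(j)`. -/
def IsHierIn (d₀ α : ℝ) (N : ℕ) (W : Set (Site d)) : ℕ → Site d → Prop
  | 0, _ => True
  | 1, j => ∃ (m : ℕ) (C : Fin (m + 1) → Set (Site d)),
      m + 1 ≤ N ∧
      W ∩ LambdaS d₀ α 1 j = ⋃ s, C s ∧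
      (∀ s, diamLE (C s) (4 * ⌊3 * d₀⌋)) ∧
      C 0 ⊆ LambdaS d₀ α 0 j ∧
      (∀ s t, s ≠ t → setDistGE (C s) (C t) (2 * nscale d₀ α 1))
  | (k + 2), j => ∃ (m : ℕ) (C : Fin (m + 1) → Set (Site d)),
      m + 1 ≤ N ∧
      W ∩ LambdaS d₀ α (k + 2) j = ⋃ s, C s ∧
      C 0 ⊆ LambdaS d₀ α (k + 1) j ∧
      (∀ s t, s ≠ t → setDistGE (C s) (C t) (2 * nscale d₀ α (k + 2))) ∧
      IsHierIn d₀ α N W (k + 1) j ∧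
      (∀ s : Fin (m + 1), s ≠ 0 → ∃ js : Site d,
        LambdaS d₀ α (k + 1) js ⊆ LambdaS d₀ α (k + 2) j ∧
        C s ⊆ LambdaS d₀ α (k + 1) js ∧
        IsHierIn d₀ α N W (k + 1) js)

/-- `V_hi` is a hierarchical potential with scales `d₀, α`, well density `N`
and barrier height `h`. -/
def IsHierPot (d₀ α : ℝ) (N : ℕ) (h : ℝ) (Vhi : Site d → ℝ) : Prop :=
  (∀ x, Vhi x = 0 ∨ Vhi x = h) ∧
  ∀ k : ℕ, 1 ≤ k → IsHierIn d₀ α N {x | Vhi x = 0} k 0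

/-- The parameter `ι = min{1/100, (h - 4d - β)/2}`. -/
def iota (d : ℕ) (h β : ℝ) : ℝ := min (1 / 100) ((h - 4 * d - β) / 2)

/-- `ℙ` is the i.i.d. Bernoulli(1/2) product measure on `{0,1}^{ℤ^d}`. -/
def IsBernoulliProduct (d : ℕ) (ℙ : MeasureTheory.Measure (Site d → Bool)) : Prop :=
  ∀ (S : Finset (Site d)) (v : Site d → Bool),
    ℙ {ω | ∀ x ∈ S, ω x = v x} = (1 / 2 : ℝ≥0∞) ^ S.card

/-- The lattice box of (integer) radius `R` about `c`, as a finset. -/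
def boxF {d : ℕ} (c : Site d) (R : ℤ) : Finset (Site d) :=
  Fintype.piFinset fun i => Finset.Icc (c i - R) (c i + R)

/-- The block `Λ_k(j)` as a finset. -/
def LambdaF {d : ℕ} (d₀ α : ℝ) (k : ℕ) (j : Site d) : Finset (Site d) :=
  boxF j (2 * ⌊3 * nscale d₀ α k⌋)

/-- `Λ̄_k(j)`, the `(d_{k+1}/10)`-neighborhood of `Λ_k(j)`, as a finset. -/
def barLambdaF {d : ℕ} (d₀ α : ℝ) (k : ℕ) (j : Site d) : Finset (Site d) :=
  boxF j (2 * ⌊3 * nscale d₀ α k⌋ + ⌊nscale d₀ α (k + 1) / 10⌋)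

/-- The Dirichlet restriction `H_Λ = R_Λ H(ω) R_Λ` of `H(ω) = 2d - Δ + V_hi + βω`,
as a matrix indexed by `Λ`: its entries are `2d + V_hi(x) + βω(x)` on the diagonal and
`-1` between nearest neighbors. -/
def HMat {d : ℕ} (Vhi : Site d → ℝ) (β : ℝ) (ω : Site d → Bool) (Λ : Finset (Site d)) :
    Matrix Λ Λ ℝ := fun x y =>
  (if x = y then 2 * d + Vhi (x : Site d) + β * (if ω (x : Site d) then 1 else 0) else 0)
  - (if l1dist (x : Site d) (y : Site d) = 1 then 1 else 0)
/-- The rate `γ₀ = log(1 + (h - 4d - β - ι)/(2d))`. -/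
def gamma0 (d : ℕ) (h β : ℝ) : ℝ :=
  Real.log (1 + (h - 4 * d - β - iota d h β) / (2 * d))


open Filter Topology

/-- A Hermitian matrix has no approximate eigenvector of defect smaller than the distance from
the approximate eigenvalue to the spectrum. -/
theorem sq_mul_sum_sq_le_of_le_dist_spectrum {n : Type*} [Fintype n] [DecidableEq n]
    {A : Matrix n n ℝ} (hA : A.IsHermitian) (v : n → ℝ) (E δ : ℝ) (hδ : 0 ≤ δ)
    (hspec : ∀ μ ∈ spectrum ℝ A, δ ≤ |E - μ|) :
    δ ^ 2 * ∑ i, v i ^ 2 ≤ ∑ i, ((A.mulVec v) i - E * v i) ^ 2 := by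
  set b := hA.eigenvectorBasis
  set v' : EuclideanSpace ℝ n := WithLp.toLp 2 v
  set u' : EuclideanSpace ℝ n := WithLp.toLp 2 (A.mulVec v - E • v)
  have hv : ∑ i, v i ^ 2 = ∑ i, ‖inner ℝ (b i) v'‖ ^ 2 := by
    rw [b.sum_sq_norm_inner_right v', EuclideanSpace.norm_sq_eq]
    simp [v']
  have hu : ∑ i, ((A.mulVec v) i - E * v i) ^ 2 = ∑ i, ‖inner ℝ (b i) u'‖ ^ 2 := by
    rw [b.sum_sq_norm_inner_right u', EuclideanSpace.norm_sq_eq]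
    simp [u']
  have key : ∀ i, inner ℝ (b i) u' = (hA.eigenvalues i - E) * inner ℝ (b i) v' := by
    intro i
    have h1 := hA.mulVec_eigenvectorBasis i
    have hAt : A.transpose = A := by
      rw [← Matrix.conjTranspose_eq_transpose_of_trivial]; exact hA
    have h2 : A.mulVec v ⬝ᵥ (b i).ofLp = hA.eigenvalues i * (v ⬝ᵥ (b i).ofLp) := by
      calc A.mulVec v ⬝ᵥ (b i).ofLp = v ⬝ᵥ A.mulVec (b i).ofLp := by
            rw [Matrix.dotProduct_mulVec, ← Matrix.mulVec_transpose, hAt]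
        _ = _ := by rw [h1, dotProduct_smul, smul_eq_mul]
    simp only [EuclideanSpace.inner_eq_star_dotProduct, u', v', star_trivial, sub_dotProduct,
      smul_dotProduct, smul_eq_mul, h2]
    ring
  rw [hv, hu, Finset.mul_sum]
  refine Finset.sum_le_sum fun i _ => ?_
  rw [key i, norm_mul, mul_pow]
  gcongr
  rw [Real.norm_eq_abs, abs_sub_comm]
  exact hspec _ (hA.eigenvalues_mem_spectrum_real i)

theorem linf_le_iff {x : Site d} {n : ℕ} : linf x ≤ n ↔ ∀ i, |x i| ≤ n := by
  simp only [linf, Finset.sup_le_iff, Finset.mem_univ, true_implies]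
  refine forall_congr' fun i => ?_
  rw [Int.abs_eq_natAbs, Nat.cast_le]

theorem linf_add_le (x y : Site d) : linf (x + y) ≤ linf x + linf y := by
  have hx := linf_le_iff.1 (le_refl (linf x))
  have hy := linf_le_iff.1 (le_refl (linf y))
  refine linf_le_iff.2 fun i => (abs_add_le _ _).trans ?_
  push_cast
  exact add_le_add (hx i) (hy i)

theorem linf_neg (x : Site d) : linf (-x) = linf x := by simp [linf]

theorem linfDist_eq (x y : Site d) : linfDist x y = linf (x - y) := rfl

theorem linf_unit_le (i : Fin d) : linf (unit i) ≤ 1 := by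
  refine linf_le_iff.2 fun j => ?_
  unfold unit
  split_ifs <;> simp

theorem linf_add_unit (x : Site d) (i : Fin d) :
    linf (x + unit i) ≤ linf x + 1 ∧ linf x ≤ linf (x + unit i) + 1 := by
  have h1 := linf_add_le x (unit i)
  have h2 := linf_add_le (x + unit i) (-unit i)
  have h3 := linf_unit_le i
  rw [add_neg_cancel_right, linf_neg] at h2
  omega

theorem linf_sub_unit (x : Site d) (i : Fin d) :
    linf (x - unit i) ≤ linf x + 1 ∧ linf x ≤ linf (x - unit i) + 1 := by
  have h := linf_add_unit (x - unit i) i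
  rw [sub_add_cancel] at h
  exact h.symm

theorem mem_boxF_zero {R : ℕ} {x : Site d} : x ∈ boxF 0 (R : ℤ) ↔ linf x ≤ R := by
  rw [linf_le_iff]
  simp [boxF, abs_le]

theorem card_boxF_zero (R : ℕ) : (boxF (0 : Site d) (R : ℤ)).card = (2 * R + 1) ^ d := by
  simp only [boxF, Fintype.card_piFinset, Int.card_Icc, Finset.prod_const, Finset.card_univ,
    Fintype.card_fin, Pi.zero_apply]
  congr 1
  omega

theorem abs_discLap_le (f : Site d → ℝ) (x : Site d) (B : ℝ)
    (hB : ∀ i, |f (x + unit i)| ≤ B ∧ |f (x - unit i)| ≤ B) : |discLap f x| ≤ 2 * d * B := by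
  calc |discLap f x| ≤ ∑ i : Fin d, |f (x + unit i) + f (x - unit i)| :=
        Finset.abs_sum_le_sum_abs _ _
    _ ≤ ∑ _i : Fin d, (B + B) :=
        Finset.sum_le_sum fun i _ => (abs_add_le _ _).trans (add_le_add (hB i).1 (hB i).2)
    _ = 2 * d * B := by simp; ring

/-- Exponential decay inside a barrier annulus: a solution shrinks by a factor `q` with each
lattice step away from the boundary of the annulus. -/
theorem abs_le_pow_mul_of_barrier {ψ : Site d → ℝ} {q M : ℝ} {a b : ℕ}
    (hstep : ∀ x : Site d, a ≤ linf x → linf x ≤ b → ∀ B : ℝ,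
      (∀ i, |ψ (x + unit i)| ≤ B ∧ |ψ (x - unit i)| ≤ B) → |ψ x| ≤ q * B)
    (hM : ∀ x, linf x ≤ b → |ψ x| ≤ M) (r : ℕ) :
    ∀ x : Site d, a + r ≤ linf x → linf x + r ≤ b → |ψ x| ≤ q ^ r * M := by
  induction r with
  | zero => intro x _ h2; simpa using hM x h2
  | succ r ih =>
    intro x h1 h2
    rw [pow_succ', mul_assoc]
    refine hstep x (by omega) (by omega) _ fun i => ⟨ih _ ?_ ?_, ih _ ?_ ?_⟩ <;>
    · have := linf_add_unit x i
      have := linf_sub_unit x i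
      omega

theorem abs_le_mul_of_hamAct_eq {Vhi ψ : Site d → ℝ} {β h ℰ : ℝ} {ω : Site d → Bool}
    (hd : 1 ≤ d) (hβ0 : 0 ≤ β) (hh : 4 * (d : ℝ) + β < h) (hℰ : ℰ ≤ 4 * (d : ℝ) + β)
    {x : Site d} (hx : hamAct Vhi β ω ψ x = ℰ * ψ x) (hV : Vhi x = h) {B : ℝ}
    (hB : ∀ i, |ψ (x + unit i)| ≤ B ∧ |ψ (x - unit i)| ≤ B) :
    |ψ x| ≤ (1 + (h - 4 * d - β) / (2 * d))⁻¹ * B := by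
  have hd' : (0 : ℝ) < d := by exact_mod_cast hd
  have hL := abs_discLap_le ψ x B hB
  have hω : 0 ≤ β * (if ω x then (1 : ℝ) else 0) := by split_ifs <;> simp [hβ0]
  have h1 : discLap ψ x = (2 * d + h + β * (if ω x then 1 else 0) - ℰ) * ψ x := by
    unfold hamAct at hx
    rw [hV] at hx
    linarith
  have h2 : (2 * d + (h - 4 * d - β)) * |ψ x| ≤ 2 * d * B := by
    refine le_trans ?_ hL
    rw [h1, abs_mul]
    gcongr
    refine le_trans ?_ (le_abs_self _)
    linarith
  have h3 : 0 < 1 + (h - 4 * d - β) / (2 * d) := by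
    have : 0 < (h - 4 * d - β) / (2 * d) := by apply div_pos <;> linarith
    linarith
  rw [inv_mul_eq_div, le_div_iff₀ h3]
  have h4 : 2 * d * (|ψ x| * (1 + (h - 4 * d - β) / (2 * d))) =
      (2 * d + (h - 4 * d - β)) * |ψ x| := by
    field_simp
  nlinarith

theorem l1dist_comm (x y : Site d) : l1dist x y = l1dist y x := by
  simp only [l1dist, abs_sub_comm]

theorem l1dist_add_unit (x : Site d) (i : Fin d) : l1dist x (x + unit i) = 1 := by
  simp [l1dist, unit, apply_ite abs]

theorem l1dist_sub_unit (x : Site d) (i : Fin d) : l1dist x (x - unit i) = 1 := by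
  simp [l1dist, unit, apply_ite abs]

theorem unit_inj {i j : Fin d} : unit i = unit j ↔ i = j := by
  refine ⟨fun h => ?_, fun h => by rw [h]⟩
  have := congrFun h i
  by_contra hij
  simp [unit, hij] at this

theorem add_unit_ne_sub_unit {x : Site d} {i j : Fin d} : x + unit i ≠ x - unit j := by
  intro h
  have h := congrFun h i
  simp only [Pi.add_apply, Pi.sub_apply, unit, if_true] at h
  split_ifs at h <;> omega

theorem eq_add_or_sub_unit_of_l1dist {x y : Site d} (h : l1dist x y = 1) :
    ∃ i, y = x + unit i ∨ y = x - unit i := by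
  obtain ⟨i, hi⟩ : ∃ i, x i ≠ y i := by
    by_contra! hne
    simp [l1dist, hne] at h
  have hsplit : |x i - y i| + ∑ j ∈ Finset.univ.erase i, |x j - y j| = ∑ j, |x j - y j| :=
    Finset.add_sum_erase Finset.univ (fun j => |x j - y j|) (Finset.mem_univ i)
  have hpos : 1 ≤ |x i - y i| := Int.one_le_abs (sub_ne_zero.2 hi)
  have hnn : 0 ≤ ∑ j ∈ Finset.univ.erase i, |x j - y j| :=
    Finset.sum_nonneg fun j _ => abs_nonneg _
  unfold l1dist at h
  have h0 : ∑ j ∈ Finset.univ.erase i, |x j - y j| = 0 := by omega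
  have h1 : |x i - y i| = 1 := by omega
  have hj : ∀ j, j ≠ i → y j = x j := fun j hji => by
    have := (Finset.sum_eq_zero_iff_of_nonneg fun j _ => abs_nonneg _).1 h0 j (by simp [hji])
    rw [abs_eq_zero] at this
    omega
  refine ⟨i, ?_⟩
  rcases (abs_eq zero_le_one).1 h1 with h2 | h2
  · right
    funext j
    by_cases hji : j = i
    · subst hji; simp [unit]; omega
    · simp [unit, hji, hj j hji]
  · left
    funext j
    by_cases hji : j = i
    · subst hji; simp [unit]; omega
    · simp [unit, hji, hj j hji]

theorem sum_ite_unit_eq_ite_l1dist (x y : Site d) :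
    ∑ i : Fin d, ((if y = x + unit i then (1 : ℝ) else 0) + if y = x - unit i then 1 else 0) =
      if l1dist x y = 1 then 1 else 0 := by
  split_ifs with h
  · obtain ⟨i, rfl | rfl⟩ := eq_add_or_sub_unit_of_l1dist h
    · simp [unit_inj, add_unit_ne_sub_unit]
    · simp [unit_inj, add_unit_ne_sub_unit.symm]
  · refine Finset.sum_eq_zero fun i _ => ?_
    rw [if_neg, if_neg, add_zero]
    · rintro rfl; exact h (l1dist_sub_unit x i)
    · rintro rfl; exact h (l1dist_add_unit x i)

/-- The Dirichlet restriction acts as the full operator on the function truncated to `Λ`. -/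
theorem HMat_mulVec (Vhi : Site d → ℝ) (β : ℝ) (ω : Site d → Bool) (Λ : Finset (Site d))
    (f : Site d → ℝ) (x : Λ) :
    (HMat Vhi β ω Λ).mulVec (fun y : Λ => f y) x =
      hamAct Vhi β ω (fun y => if y ∈ Λ then f y else 0) x := by
  have hlap : discLap (fun y => if y ∈ Λ then f y else 0) (x : Site d) =
      ∑ y : Λ, (if l1dist (x : Site d) (y : Site d) = 1 then 1 else 0) * f y := by
    rw [Finset.sum_coe_sort Λ fun y => (if l1dist (x : Site d) y = 1 then 1 else 0) * f y]
    simp_rw [← sum_ite_unit_eq_ite_l1dist, Finset.sum_mul]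
    rw [Finset.sum_comm]
    refine Finset.sum_congr rfl fun i _ => ?_
    simp [add_mul, Finset.sum_add_distrib]
  rw [hamAct, hlap]
  simp [Matrix.mulVec, dotProduct, HMat, sub_mul, Finset.sum_sub_distrib]

theorem HMat_isHermitian (Vhi : Site d → ℝ) (β : ℝ) (ω : Site d → Bool) (Λ : Finset (Site d)) :
    (HMat Vhi β ω Λ).IsHermitian := by
  ext x y
  simp only [Matrix.conjTranspose_apply, HMat, star_trivial, l1dist_comm (y : Site d) x]
  by_cases h : x = y
  · simp [h]
  · simp [h, Ne.symm h]

/-- Truncating a generalized eigenfunction that is at most `ε` just outside `Λ` creates a defect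
of at most `2dε` at each site. -/
theorem abs_HMat_mulVec_sub_le {Vhi ψ : Site d → ℝ} {β ℰ ε : ℝ} {ω : Site d → Bool}
    (hψ : ∀ x, hamAct Vhi β ω ψ x = ℰ * ψ x) (hε0 : 0 ≤ ε) {Λ : Finset (Site d)} (x : Λ)
    (hε : ∀ i : Fin d, (((x : Site d) + unit i) ∉ Λ → |ψ ((x : Site d) + unit i)| ≤ ε) ∧
      (((x : Site d) - unit i) ∉ Λ → |ψ ((x : Site d) - unit i)| ≤ ε)) :
    |(HMat Vhi β ω Λ).mulVec (fun y : Λ => ψ y) x - ℰ * ψ x| ≤ 2 * d * ε := by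
  have h1 : (HMat Vhi β ω Λ).mulVec (fun y : Λ => ψ y) x - ℰ * ψ x =
      discLap (fun y => if y ∈ Λ then 0 else ψ y) x := by
    have h2 : discLap (fun y => if y ∈ Λ then 0 else ψ y) (x : Site d) =
        discLap ψ x - discLap (fun y => if y ∈ Λ then ψ y else 0) x := by
      simp only [discLap, ← Finset.sum_sub_distrib]
      refine Finset.sum_congr rfl fun i _ => ?_
      split_ifs <;> ring
    rw [HMat_mulVec, ← hψ, h2]
    simp only [hamAct, x.2, if_true]
    ring
  rw [h1]
  refine abs_discLap_le _ _ _ fun i => ⟨?_, ?_⟩ <;> split_ifs with h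
  · simpa using hε0
  · exact (hε i).1 h
  · simpa using hε0
  · exact (hε i).2 h

/-- If a generalized eigenfunction is at least `1` somewhere in a box of radius `R` and at most
`ε` on the sphere of radius `R + 1`, then its generalized eigenvalue is close to the spectrum of
the box. -/
theorem exists_mem_spectrum_HMat_boxF {Vhi ψ : Site d → ℝ} {β ℰ ε δ : ℝ} {ω : Site d → Bool}
    (hψ : ∀ x, hamAct Vhi β ω ψ x = ℰ * ψ x) (hε0 : 0 ≤ ε) {m : Site d} (hm : 1 ≤ |ψ m|)
    {R : ℕ} (hmR : linf m ≤ R) (hε : ∀ x, linf x = R + 1 → |ψ x| ≤ ε)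
    (hδ : (2 * R + 1 : ℝ) ^ d * (2 * d * ε) < δ) :
    ∃ μ ∈ spectrum ℝ (HMat Vhi β ω (boxF (0 : Site d) (R : ℤ))), |ℰ - μ| < δ := by
  set Λ := boxF (0 : Site d) (R : ℤ) with hΛ
  have hpow : (1 : ℝ) ≤ (2 * R + 1) ^ d := one_le_pow₀ (by linarith [R.cast_nonneg (α := ℝ)])
  have hδ0 : 0 < δ := lt_of_le_of_lt (by positivity) hδ
  by_contra! hcon
  have h1 := sq_mul_sum_sq_le_of_le_dist_spectrum (HMat_isHermitian Vhi β ω Λ)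
    (fun y : Λ => ψ y) ℰ δ hδ0.le hcon
  have h2 : 1 ≤ ∑ y : Λ, ψ y ^ 2 := by
    have hmΛ : m ∈ Λ := mem_boxF_zero.2 hmR
    calc (1 : ℝ) ≤ ψ m ^ 2 := by rw [← sq_abs]; exact one_le_pow₀ hm
      _ ≤ _ := Finset.single_le_sum (f := fun y : Λ => ψ y ^ 2) (fun y _ => sq_nonneg _)
        (Finset.mem_univ (⟨m, hmΛ⟩ : Λ))
  have h3 : ∑ x : Λ, ((HMat Vhi β ω Λ).mulVec (fun y : Λ => ψ y) x - ℰ * ψ x) ^ 2 ≤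
      ∑ _x : Λ, (2 * d * ε) ^ 2 := by
    refine Finset.sum_le_sum fun x _ => ?_
    rw [← sq_abs]
    gcongr
    refine abs_HMat_mulVec_sub_le hψ hε0 x fun i => ?_
    have hx : linf (x : Site d) ≤ R := mem_boxF_zero.1 x.2
    have ha := linf_add_unit (x : Site d) i
    have hs := linf_sub_unit (x : Site d) i
    simp only [hΛ, mem_boxF_zero]
    exact ⟨fun h => hε _ (by omega), fun h => hε _ (by omega)⟩
  rw [Finset.sum_const, Finset.card_univ, Fintype.card_coe, hΛ, card_boxF_zero, nsmul_eq_mul]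
    at h3
  push_cast at h3
  have h4 : ((2 * R + 1 : ℝ) ^ d) * (2 * d * ε) ^ 2 ≤ ((2 * R + 1 : ℝ) ^ d * (2 * d * ε)) ^ 2 := by
    rw [mul_pow ((2 * R + 1 : ℝ) ^ d)]
    gcongr
    exact le_self_pow₀ hpow two_ne_zero
  have h5 : ((2 * R + 1 : ℝ) ^ d * (2 * d * ε)) ^ 2 < δ ^ 2 :=
    pow_lt_pow_left₀ hδ (by positivity) two_ne_zero
  nlinarith [sq_nonneg δ]

theorem linfDist_le_of_mem_LambdaS {d₀ α : ℝ} {k : ℕ} {j x y : Site d}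
    (hx : x ∈ LambdaS d₀ α k j) (hy : y ∈ LambdaS d₀ α k j) :
    (linfDist x y : ℝ) ≤ 12 * nscale d₀ α k := by
  have hx : (linfDist x j : ℤ) ≤ 2 * ⌊3 * nscale d₀ α k⌋ := hx
  have hy : (linfDist y j : ℤ) ≤ 2 * ⌊3 * nscale d₀ α k⌋ := hy
  have h := linf_add_le (x - j) (-(y - j))
  rw [linf_neg, ← sub_eq_add_neg, sub_sub_sub_cancel_right] at h
  simp only [← linfDist_eq] at h
  have h1 : (linfDist x y : ℤ) ≤ 4 * ⌊3 * nscale d₀ α k⌋ := by omega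
  have h2 : (linfDist x y : ℝ) ≤ 4 * (⌊3 * nscale d₀ α k⌋ : ℝ) := by exact_mod_cast h1
  linarith [Int.floor_le (3 * nscale d₀ α k)]

theorem nscale_pos {d₀ : ℝ} (hd₀ : 1 < d₀) (α : ℝ) (k : ℕ) : 0 < nscale d₀ α k :=
  Real.rpow_pos_of_pos (by linarith) _

/-- In a hierarchical potential, two well sites are either in a common cluster or far apart. -/
theorem IsHierPot.linfDist_le_or_le {d₀ α h : ℝ} {N : ℕ} {Vhi : Site d → ℝ}
    (hV : IsHierPot d₀ α N h Vhi) {k : ℕ} (hk : 1 ≤ k) {x y : Site d}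
    (hx : Vhi x = 0) (hy : Vhi y = 0)
    (hxΛ : x ∈ LambdaS d₀ α (k + 1) 0) (hyΛ : y ∈ LambdaS d₀ α (k + 1) 0) :
    (linfDist x y : ℝ) ≤ 12 * nscale d₀ α k ∨ 2 * nscale d₀ α (k + 1) ≤ linfDist x y := by
  obtain ⟨k, rfl⟩ := Nat.exists_eq_succ_of_ne_zero (Nat.one_le_iff_ne_zero.1 hk)
  obtain ⟨n, C, -, hC, hC0, hsep, -, hCs⟩ := hV.2 (k + 2) (by omega)
  have hxC : x ∈ ⋃ s, C s := by rw [← hC]; exact ⟨hx, hxΛ⟩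
  have hyC : y ∈ ⋃ s, C s := by rw [← hC]; exact ⟨hy, hyΛ⟩
  obtain ⟨s, hs⟩ := Set.mem_iUnion.1 hxC
  obtain ⟨t, ht⟩ := Set.mem_iUnion.1 hyC
  by_cases hst : s = t
  · subst hst
    left
    by_cases hs0 : s = 0
    · subst hs0
      exact linfDist_le_of_mem_LambdaS (hC0 hs) (hC0 ht)
    · obtain ⟨j, -, hj, -⟩ := hCs s hs0
      exact linfDist_le_of_mem_LambdaS (hj hs) (hj ht)
  · exact Or.inr (hsep s t hst x hs y ht)

theorem mem_LambdaS_zero_of_linf_le {d₀ α : ℝ} {k : ℕ} (hD : 1 ≤ nscale d₀ α k)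
    {x : Site d} (hx : (linf x : ℝ) ≤ nscale d₀ α k) : x ∈ LambdaS d₀ α k 0 := by
  have h1 : (linf x : ℝ) ≤ 2 * (⌊3 * nscale d₀ α k⌋ : ℝ) := by
    linarith [Int.sub_one_lt_floor (3 * nscale d₀ α k)]
  change (linfDist x 0 : ℤ) ≤ _
  rw [linfDist_eq, sub_zero]
  exact_mod_cast h1

/-- At large well-separated scales, an annulus of outer radius `d_{k+1}` contains no wells. -/
theorem IsHierPot.exists_barrier_annulus {d₀ α h : ℝ} {N : ℕ} {Vhi : Site d → ℝ}
    (hV : IsHierPot d₀ α N h Vhi) :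
    ∃ T : ℝ, ∀ k : ℕ, 1 ≤ k → T ≤ nscale d₀ α (k + 1) →
      1000 * nscale d₀ α k ≤ nscale d₀ α (k + 1) →
      ∀ x : Site d, nscale d₀ α (k + 1) / 50 ≤ linf x → (linf x : ℝ) ≤ nscale d₀ α (k + 1) →
        Vhi x = h := by
  by_cases hW : ∃ w, Vhi w = 0
  · obtain ⟨w, hw⟩ := hW
    refine ⟨1000 * linf w + 1000, fun k hk hT hc x h1 h2 => (hV.1 x).resolve_left fun hx => ?_⟩
    have hw0 : (0 : ℝ) ≤ linf w := Nat.cast_nonneg _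
    have hxw := linf_add_le x (-w)
    have hwx := linf_add_le (x - w) w
    rw [linf_neg, ← sub_eq_add_neg] at hxw
    rw [sub_add_cancel] at hwx
    have hxw' : (linf (x - w) : ℝ) ≤ linf x + linf w := by exact_mod_cast hxw
    have hwx' : (linf x : ℝ) ≤ linf (x - w) + linf w := by exact_mod_cast hwx
    rcases hV.linfDist_le_or_le hk hx hw
      (mem_LambdaS_zero_of_linf_le (by linarith) h2)
      (mem_LambdaS_zero_of_linf_le (by linarith) (by linarith)) with h3 | h3 <;>
    · rw [linfDist_eq] at h3
      linarith
  · push Not at hW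
    exact ⟨0, fun k _ _ _ x _ _ => (hV.1 x).resolve_left (hW x)⟩

theorem tendsto_nscale {d₀ α : ℝ} (hd₀ : 1 < d₀) (hα : 1 < α) :
    Tendsto (fun k => nscale d₀ α k) atTop atTop :=
  (tendsto_rpow_atTop_of_base_gt_one d₀ hd₀).comp (tendsto_pow_atTop_atTop_of_one_lt hα)

theorem eventually_mul_nscale_le {d₀ α : ℝ} (hd₀ : 1 < d₀) (hα : 1 < α) (c : ℝ) :
    ∀ᶠ k in atTop, c * nscale d₀ α k ≤ nscale d₀ α (k + 1) := by
  have h := (tendsto_rpow_atTop (sub_pos.2 hα)).comp (tendsto_nscale hd₀ hα)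
  filter_upwards [h.eventually_ge_atTop c] with k hk
  have hpos := nscale_pos hd₀ α k
  have hsucc : nscale d₀ α (k + 1) = nscale d₀ α k ^ (α - 1) * nscale d₀ α k := by
    rw [← Real.rpow_add_one hpos.ne', sub_add_cancel]
    simp only [nscale]
    rw [← Real.rpow_mul (by linarith), pow_succ]
  rw [hsucc]
  exact mul_le_mul_of_nonneg_right hk hpos.le

theorem eventually_mul_rpow_mul_exp_lt (A s : ℝ) {a b : ℝ} (hab : a < b) :
    ∀ᶠ x : ℝ in atTop, A * x ^ s * Real.exp (-b * x) < Real.exp (-a * x) := by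
  have h := (tendsto_rpow_mul_exp_neg_mul_atTop_nhds_zero s (b - a) (sub_pos.2 hab)).const_mul A
  rw [mul_zero] at h
  filter_upwards [h.eventually_lt_const one_pos] with x hx
  have hsplit : Real.exp (-b * x) = Real.exp (-(b - a) * x) * Real.exp (-a * x) := by
    rw [← Real.exp_add]; ring_nf
  rw [hsplit, ← mul_assoc, mul_assoc A]
  exact mul_lt_of_lt_one_left (Real.exp_pos _) hx

theorem eventually_exp_neg_mul_le {a c : ℝ} (ha : 0 < a) (hc : 0 < c) :
    ∀ᶠ x : ℝ in atTop, Real.exp (-a * x) ≤ c := by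
  have h : Tendsto (fun x : ℝ => Real.exp (-a * x)) atTop (𝓝 0) :=
    Real.tendsto_exp_atBot.comp (tendsto_id.const_mul_atTop_of_neg (neg_neg_of_pos ha))
  exact (h.eventually_lt_const hc).mono fun _ => le_of_lt

theorem iota_pos {h β : ℝ} (hh : 4 * (d : ℝ) + β < h) : 0 < iota d h β :=
  lt_min (by norm_num) (by linarith)

theorem gamma0_pos {h β : ℝ} (hd : 1 ≤ d) (hh : 4 * (d : ℝ) + β < h) : 0 < gamma0 d h β := by
  have hd' : (0 : ℝ) < d := by exact_mod_cast hd
  have hι : iota d h β ≤ (h - 4 * d - β) / 2 := min_le_right _ _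
  refine Real.log_pos (lt_add_of_pos_right _ (div_pos ?_ ?_)) <;> linarith

theorem inv_le_exp_neg_gamma0 {h β : ℝ} (hd : 1 ≤ d) (hh : 4 * (d : ℝ) + β < h) :
    (1 + (h - 4 * d - β) / (2 * d))⁻¹ ≤ Real.exp (-gamma0 d h β) := by
  have hd' : (0 : ℝ) < d := by exact_mod_cast hd
  have hι : iota d h β ≤ (h - 4 * d - β) / 2 := min_le_right _ _
  have hι0 := iota_pos hh
  have hpos : 0 < (h - 4 * d - β - iota d h β) / (2 * d) := by apply div_pos <;> linarith
  rw [Real.exp_neg, gamma0, Real.exp_log (by linarith)]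
  refine inv_anti₀ (by linarith) (add_le_add_right ?_ 1)
  exact div_le_div_of_nonneg_right (by linarith) (by positivity)

/-- Decay of a polynomially bounded generalized eigenfunction on a sphere surrounded by a barrier
annulus `D / 50 ≤ |x| ≤ D`. -/
theorem abs_le_exp_of_barrier_annulus {Vhi ψ : Site d → ℝ} {β h ℰ A p D : ℝ}
    {ω : Site d → Bool} (hd : 1 ≤ d) (hβ0 : 0 ≤ β) (hh : 4 * (d : ℝ) + β < h)
    (hℰ : ℰ ≤ 4 * (d : ℝ) + β) (hψ : ∀ x, hamAct Vhi β ω ψ x = ℰ * ψ x)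
    (hA : 0 ≤ A) (hp : 0 ≤ p) (hgrow : ∀ x, |ψ x| ≤ A * ((linf x : ℝ) + 1) ^ p)
    (hD : 1000 ≤ D)
    (hbar : ∀ x : Site d, D / 50 ≤ linf x → (linf x : ℝ) ≤ D → Vhi x = h)
    {x : Site d} (hx1 : D / 10 - 1 ≤ linf x) (hx2 : (linf x : ℝ) ≤ D / 2) :
    |ψ x| ≤ A * 2 ^ p * Real.exp (gamma0 d h β) * D ^ p *
      Real.exp (-(gamma0 d h β / 20) * D) := by
  have hD0 : 0 ≤ D := by linarith
  have hγ := gamma0_pos hd hh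
  have hr := Nat.floor_le (show 0 ≤ D / 20 by linarith)
  have hr' := Nat.sub_one_lt_floor (D / 20)
  have hb := Nat.floor_le hD0
  have hb' := Nat.sub_one_lt_floor D
  have ha := Nat.le_ceil (D / 50)
  have ha' := Nat.ceil_lt_add_one (show 0 ≤ D / 50 by linarith)
  have hq0 : 0 ≤ (1 + (h - 4 * d - β) / (2 * d))⁻¹ := by
    have : 0 ≤ h - 4 * d - β := by linarith
    positivity
  have hmain := abs_le_pow_mul_of_barrier (ψ := ψ) (M := A * (2 * D) ^ p)
    (a := ⌈D / 50⌉₊) (b := ⌊D⌋₊)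
    (fun y h1 h2 B hB => abs_le_mul_of_hamAct_eq hd hβ0 hh hℰ (hψ y)
      (hbar y (Nat.ceil_le.1 h1) ((Nat.le_floor_iff hD0).1 h2)) hB)
    (fun y hy => (hgrow y).trans (by
      have hy := (Nat.le_floor_iff hD0).1 hy
      gcongr
      linarith))
    ⌊D / 20⌋₊ x
    (by rw [← Nat.cast_le (α := ℝ)]; push_cast; linarith)
    (by rw [← Nat.cast_le (α := ℝ)]; push_cast; linarith)
  calc |ψ x| ≤ _ := hmain
    _ ≤ Real.exp (-gamma0 d h β) ^ ⌊D / 20⌋₊ * (A * (2 * D) ^ p) := by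
      gcongr
      exact inv_le_exp_neg_gamma0 hd hh
    _ ≤ (Real.exp (gamma0 d h β) * Real.exp (-(gamma0 d h β / 20) * D)) *
        (A * (2 * D) ^ p) := by
      gcongr
      rw [← Real.exp_nat_mul, ← Real.exp_add, Real.exp_le_exp]
      nlinarith
    _ = _ := by
      rw [Real.mul_rpow zero_le_two hD0]
      ring

/-- **Generalized eigenvalues are well approximated by eigenvalues of finite blocks**
(Lemma 5.1).

If `ψ` is a polynomially bounded generalized eigenfunction of `H(ω)` with generalized
eigenvalue `ℰ ∈ [0, 4d+β]` and `|ψ(m_ℰ)| ≥ 1` at some site `m_ℰ`, then there is a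
scale `K₁ = K₁(ℰ, ω)` such that for all `k ≥ K₁`,
`dist(ℰ, Spec(H_{Λ̄_k}) ∩ [-ι/2, 4d+β+ι/2]) < exp(-(γ₀/50) d_{k+1})`;
in particular that intersection is nonempty. -/
theorem generalized_eigenvalue_approximation
    (d : ℕ) (hd : 1 ≤ d)
    (d₀ α : ℝ) (hd₀ : 1 < d₀) (hα : 1 < α)
    (N : ℕ) (hN : 1 ≤ N)
    (h β : ℝ) (hh : 4 * (d : ℝ) + 1 < h) (hβ0 : 0 < β) (hβ1 : β ≤ 1)
    (Vhi : Site d → ℝ) (hVhi : IsHierPot d₀ α N h Vhi)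
    (ω : Site d → Bool)
    (ℰ : ℝ) (hℰ : ℰ ∈ Set.Icc 0 (4 * (d : ℝ) + β))
    (ψ : Site d → ℝ) (hψeq : ∀ x, hamAct Vhi β ω ψ x = ℰ * ψ x)
    (m : Site d) (hm : 1 ≤ |ψ m|)
    (C₁ : ℝ) (hC₁ : 0 < C₁)
    (hgrow : ∀ x, |ψ x| ≤ C₁ * ((linf m : ℝ) + 1) ^ ((d : ℝ) / 2 + 1) *
      ((linf x : ℝ) + 1) ^ ((d : ℝ) / 2 + 1)) :
    ∃ K₁ : ℕ, ∀ k : ℕ, K₁ ≤ k →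
      ∃ μ ∈ spectrum ℝ (HMat Vhi β ω (barLambdaF d₀ α k (0 : Site d))),
        μ ∈ Set.Icc (-(iota d h β) / 2) (4 * (d : ℝ) + β + iota d h β / 2) ∧
        |ℰ - μ| < Real.exp (-(gamma0 d h β / 50) * nscale d₀ α (k + 1)) := by
  have hh' : 4 * (d : ℝ) + β < h := by linarith
  have hγ := gamma0_pos hd hh'
  have hι := iota_pos hh'
  set A : ℝ := C₁ * ((linf m : ℝ) + 1) ^ ((d : ℝ) / 2 + 1) with hA
  set p : ℝ := (d : ℝ) / 2 + 1 with hp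
  set γ : ℝ := gamma0 d h β with hγdef
  set G : ℝ := A * 2 ^ p * Real.exp γ with hG
  have hA0 : 0 ≤ A := by positivity
  have hp0 : 0 ≤ p := by positivity
  obtain ⟨T, hT⟩ := hVhi.exists_barrier_annulus
  have hscale : Tendsto (fun k => nscale d₀ α (k + 1)) atTop atTop :=
    (tendsto_nscale hd₀ hα).comp (tendsto_add_atTop_nat 1)
  have hev : ∀ᶠ D : ℝ in atTop, T ≤ D ∧ 1000 * (linf m : ℝ) + 1000 ≤ D ∧
      2 * d * G * D ^ (d + p) * Real.exp (-(γ / 20) * D) < Real.exp (-(γ / 50) * D) ∧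
      Real.exp (-(γ / 50) * D) ≤ iota d h β / 2 :=
    (eventually_ge_atTop T).and <| (eventually_ge_atTop _).and <|
      (eventually_mul_rpow_mul_exp_lt _ _ (by linarith)).and <|
        eventually_exp_neg_mul_le (by linarith) (by linarith)
  obtain ⟨K₁, hK₁⟩ := eventually_atTop.1 ((hscale.eventually hev).and
    ((eventually_mul_nscale_le hd₀ hα 1000).and (eventually_ge_atTop 1)))
  refine ⟨K₁, fun k hk => ?_⟩
  obtain ⟨⟨hTD, hmD, hfin, hsmall⟩, hc, hk1⟩ := hK₁ k hk
  have hbar := hT k hk1 hTD hc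
  have hcpos := nscale_pos hd₀ α k
  obtain ⟨R, hR⟩ : ∃ R : ℕ,
      2 * ⌊3 * nscale d₀ α k⌋ + ⌊nscale d₀ α (k + 1) / 10⌋ = (R : ℤ) :=
    Int.eq_ofNat_of_zero_le (by
      have := nscale_pos hd₀ α (k + 1)
      positivity)
  rw [barLambdaF, hR]
  set c := nscale d₀ α k
  set D := nscale d₀ α (k + 1)
  have hlm : (0 : ℝ) ≤ linf m := Nat.cast_nonneg _
  have hD : 1000 ≤ D := by linarith
  have hD0 : 0 < D := by linarith
  have hRr : (R : ℝ) = 2 * (⌊3 * c⌋ : ℝ) + (⌊D / 10⌋ : ℝ) := by exact_mod_cast hR.symm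
  have hfc0 : (0 : ℝ) ≤ ⌊3 * c⌋ := by
    exact_mod_cast Int.floor_nonneg.2 (by positivity : 0 ≤ 3 * c)
  have hfc := Int.floor_le (3 * c)
  have hfD := Int.floor_le (D / 10)
  have hfD' := Int.sub_one_lt_floor (D / 10)
  set ε : ℝ := G * D ^ p * Real.exp (-(γ / 20) * D) with hε
  have hε0 : 0 ≤ ε := by positivity
  have hδ : (2 * R + 1 : ℝ) ^ d * (2 * d * ε) < Real.exp (-(γ / 50) * D) := by
    calc (2 * R + 1 : ℝ) ^ d * (2 * d * ε) ≤ D ^ d * (2 * d * ε) := by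
          gcongr
          linarith
      _ = 2 * d * G * D ^ (d + p) * Real.exp (-(γ / 20) * D) := by
          rw [Real.rpow_add hD0, Real.rpow_natCast, hε]
          ring
      _ < _ := hfin
  obtain ⟨μ, hμ, hlt⟩ := exists_mem_spectrum_HMat_boxF hψeq hε0 hm (R := R)
    (by rw [← Nat.cast_le (α := ℝ)]; linarith)
    (fun x hx => by
      have hx' : (linf x : ℝ) = R + 1 := by exact_mod_cast hx
      exact abs_le_exp_of_barrier_annulus hd hβ0.le hh' hℰ.2 hψeq hA0 hp0 hgrow hD hbar
        (by linarith) (by linarith)) hδ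
  refine ⟨μ, hμ, ?_, hlt⟩
  have habs := abs_lt.1 (hlt.trans_le hsmall)
  have hℰ1 := hℰ.1
  have hℰ2 := hℰ.2
  constructor <;> linarith

end HierABM
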